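/- Let v ∈ ℤ^d with v ≠ 0 and ‖v‖_∞ ≤ M (so v ∈ S_M), and define π : S_M → S_M by π(s) := [s+v] for s ≠ −v and π(−v) := v. Then π is a bijection of S_M, and for every configuration η with η_v = 0 one has η^{0,v}_s = η_{π(s)} for all s ∈ S_M, i.e. the tagged-particle jump acts as a relabeling of the sites on configurations whose target site is empty. -/

import Mathlib

open Finset Matrix

/-- The set of sites `S_M = {-M,…,M}^d \ {0}`. -/
noncomputable def SM (d M : ℕ) : Finset (Fin d → ℤ) :=
  (Fintype.piFinset fun _ : Fin d => Finset.Icc (-(M : ℤ)) M).erase 0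

abbrev Site (d M : ℕ) : Type := {x : Fin d → ℤ // x ∈ SM d M}

/-- A configuration is a map `S_M → {0,1}`. -/
abbrev Cfg (d M : ℕ) : Type := Site d M → Bool

/-- `wrap M x` is the unique element of `[-M, M]` congruent to `x` mod `2M+1`. -/
def wrap (M : ℕ) (x : ℤ) : ℤ := (x + M) % (2 * M + 1) - M

/-- `[s]`: coordinatewise wrap into `{-M,…,M}^d`. -/
def wrapVec (d M : ℕ) (s : Fin d → ℤ) : Fin d → ℤ := fun i => wrap M (s i)

/-- Value of a configuration at an arbitrary point of `ℤ^d` (junk value `false` off `S_M`). -/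
noncomputable def get (d M : ℕ) (η : Cfg d M) (s : Fin d → ℤ) : Bool :=
  if h : s ∈ SM d M then η ⟨s, h⟩ else false

/-- The configuration `η^{y+v, y}`, exchanging the values of `η` at `y` and `[y+v]`. -/
noncomputable def swapCfg (d M : ℕ) (η : Cfg d M) (y v : Fin d → ℤ) : Cfg d M := fun s =>
  if (s : Fin d → ℤ) = y then get d M η (wrapVec d M (y + v))
  else if (s : Fin d → ℤ) = wrapVec d M (y + v) then get d M η y
  else η s

/-- The configuration `η^{0, v}` (tagged-particle jump):
`η^{0,v}_s = η_{[s+v]}` for `s ≠ -v` and `η^{0,v}_{-v} = 0`. -/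
noncomputable def jumpCfg (d M : ℕ) (η : Cfg d M) (v : Fin d → ℤ) : Cfg d M := fun s =>
  if (s : Fin d → ℤ) = -v then false
  else get d M η (wrapVec d M ((s : Fin d → ℤ) + v))

/-- Number of occupied sites of a configuration. -/
noncomputable def occ (d M : ℕ) (η : Cfg d M) : ℕ := (univ.filter fun s => η s = true).card

/-- `C_{M,ℓ}`: configurations with exactly `ℓ` occupied sites. -/
noncomputable def CML (d M ℓ : ℕ) : Finset (Cfg d M) := univ.filter fun η => occ d M η = ℓ

/-- `N = (2M+1)^d - 1`, the cardinality of `S_M`. -/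
def NN (d M : ℕ) : ℕ := (2 * M + 1) ^ d - 1

/-- The summand (over configurations `η`) of the functionals `A^u_M` and `A^u_{M,ℓ}`. -/
noncomputable def termA (d M K : ℕ) (v : Fin K → Fin d → ℤ) (p : Fin K → ℝ)
    (u : Fin d → ℝ) (Ψ : Cfg d M → ℝ) (η : Cfg d M) : ℝ :=
  ∑ k : Fin K, p k *
    ((1 - (if get d M η (v k) = true then (1 : ℝ) else 0)) *
        ((∑ i, u i * ((v k i : ℝ))) + Ψ (jumpCfg d M η (v k)) - Ψ η) ^ 2
      + (1 / 2) * ∑ y ∈ (SM d M).filter (fun y => y + v k ≠ 0),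
          (Ψ (swapCfg d M η y (v k)) - Ψ η) ^ 2)

/-- The functional `A^u_M`. -/
noncomputable def AFull (d M K : ℕ) (v : Fin K → Fin d → ℤ) (p : Fin K → ℝ)
    (u : Fin d → ℝ) (Ψ : Cfg d M → ℝ) : ℝ :=
  ∑ η : Cfg d M, termA d M K v p u Ψ η

/-- The level functional `A^u_{M,ℓ}`. -/
noncomputable def AL (d M K : ℕ) (v : Fin K → Fin d → ℤ) (p : Fin K → ℝ)
    (u : Fin d → ℝ) (ℓ : ℕ) (Ψ : Cfg d M → ℝ) : ℝ :=
  ((CML d M ℓ).card : ℝ)⁻¹ * ∑ η ∈ CML d M ℓ, termA d M K v p u Ψ η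

theorem mem_SM_iff (d M : ℕ) (x : Fin d → ℤ) :
    x ∈ SM d M ↔ x ≠ 0 ∧ ∀ i, -(M : ℤ) ≤ x i ∧ x i ≤ M := by
  simp [SM]

theorem wrap_range (M : ℕ) (x : ℤ) : -(M : ℤ) ≤ wrap M x ∧ wrap M x ≤ M := by
  unfold wrap
  have h1 := Int.emod_nonneg (x + M) (b := 2 * (M : ℤ) + 1) (by omega)
  have h2 := Int.emod_lt_of_pos (x + M) (b := 2 * (M : ℤ) + 1) (by omega)
  omega

theorem wrap_self (M : ℕ) (x : ℤ) (h1 : -(M : ℤ) ≤ x) (h2 : x ≤ M) : wrap M x = x := by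
  unfold wrap
  rw [Int.emod_eq_of_lt (by omega) (by omega)]
  omega

theorem wrap_cancel (M : ℕ) (a b c : ℤ) (ha : -(M : ℤ) ≤ a ∧ a ≤ M) (hb : -(M : ℤ) ≤ b ∧ b ≤ M)
    (h : wrap M (a + c) = wrap M (b + c)) : a = b := by
  unfold wrap at h
  have h' : (a + c + M) % (2 * (M : ℤ) + 1) = (b + c + M) % (2 * (M : ℤ) + 1) := by omega
  have h3 := Int.emod_emod_of_dvd (a - b) (dvd_refl (2 * (M : ℤ) + 1))
  have h4 : (2 * (M : ℤ) + 1) ∣ (a - b) := by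
    have := Int.ModEq.dvd (n := 2 * (M : ℤ) + 1) (a := b + c + M) (b := a + c + M) h'.symm
    convert this using 1
    ring
  have h5 : a - b = 0 := by
    apply Int.eq_zero_of_abs_lt_dvd h4
    rw [abs_lt]
    omega
  omega

theorem wrapVec_cancel (d M : ℕ) (a b c : Fin d → ℤ) (ha : ∀ i, -(M : ℤ) ≤ a i ∧ a i ≤ M)
    (hb : ∀ i, -(M : ℤ) ≤ b i ∧ b i ≤ M)
    (h : wrapVec d M (a + c) = wrapVec d M (b + c)) : a = b := by
  funext i
  exact wrap_cancel M _ _ (c i) (ha i) (hb i) (congrFun h i)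

theorem wrapVec_self (d M : ℕ) (a : Fin d → ℤ) (ha : ∀ i, -(M : ℤ) ≤ a i ∧ a i ≤ M) :
    wrapVec d M a = a := by
  funext i
  exact wrap_self M _ (ha i).1 (ha i).2

/-- the map `π(s) = [s+v]` for `s ≠ -v`, `π(-v) = v`, is a bijection of
`S_M`, and on configurations with `η_v = 0` the tagged-particle jump `η^{0,v}` is the
relabeling `η ∘ π`. -/
theorem jump_is_relabeling (d M : ℕ) (hd : 1 ≤ d) (hM : 1 ≤ M)
    (v : Fin d → ℤ) (hv : v ∈ SM d M) :
    ∃ π : Site d M ≃ Site d M,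
      (∀ s : Site d M,
          ((π s : Fin d → ℤ)
            = if (s : Fin d → ℤ) = -v then v else wrapVec d M ((s : Fin d → ℤ) + v))) ∧
      (∀ η : Cfg d M, get d M η v = false →
          ∀ s : Site d M, jumpCfg d M η v s = η (π s)) := by
  obtain ⟨hv0, hvr⟩ := (mem_SM_iff d M v).1 hv
  have hz : ∀ i, -(M : ℤ) ≤ (0 : Fin d → ℤ) i ∧ (0 : Fin d → ℤ) i ≤ M := by
    intro i; simp
  have hn : ∀ i, -(M : ℤ) ≤ (-v) i ∧ (-v) i ≤ M := by
    intro i; have := hvr i; simp only [Pi.neg_apply]; omega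
  have hmem : ∀ s : Site d M,
      (if (s : Fin d → ℤ) = -v then v else wrapVec d M ((s : Fin d → ℤ) + v)) ∈ SM d M := by
    intro s
    obtain ⟨hs0, hsr⟩ := (mem_SM_iff d M s).1 s.2
    split_ifs with h
    · exact hv
    · rw [mem_SM_iff]
      refine ⟨fun h0 => h ?_, fun i => wrap_range M _⟩
      apply wrapVec_cancel d M _ _ v hsr hn
      rw [h0, neg_add_cancel, wrapVec_self d M 0 hz]
  have hne : ∀ s : Site d M, wrapVec d M ((s : Fin d → ℤ) + v) ≠ v := by
    intro s h
    obtain ⟨hs0, hsr⟩ := (mem_SM_iff d M s).1 s.2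
    apply hs0
    apply wrapVec_cancel d M _ _ v hsr hz
    rw [h, zero_add, wrapVec_self d M v hvr]
  let f : Site d M → Site d M := fun s => ⟨_, hmem s⟩
  have hf : Function.Injective f := by
    intro s t h
    have h' := congrArg Subtype.val h
    simp only [f] at h'
    apply Subtype.ext
    split_ifs at h' with h1 h2 h2
    · rw [h1, h2]
    · exact absurd h'.symm (hne t)
    · exact absurd h' (hne s)
    · exact wrapVec_cancel d M _ _ v ((mem_SM_iff d M s).1 s.2).2 ((mem_SM_iff d M t).1 t.2).2 h'
  refine ⟨Equiv.ofBijective f (Finite.injective_iff_bijective.1 hf), fun s => rfl, ?_⟩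
  intro η hη s
  rw [Equiv.ofBijective_apply]
  have hget : get d M η (f s : Fin d → ℤ) = η (f s) := by
    exact dif_pos (f s).2
  rw [← hget]
  unfold jumpCfg
  simp only [f]
  split_ifs with h
  · exact hη.symm
  · rfl
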